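/- arXiv:1912.11436 — 6 statements merged into one kernel-verified Lean document; each statement's English description precedes it below -/
import Mathlib

section
/- (Theorem 1, split version) For any α ∈ (0,1), the universal confidence set C_n = {θ ∈ Θ : T_n(θ) ≤ 1/α} satisfies P_{θ*}(θ* ∈ C_n) ≥ 1 − α, i.e., P_{θ*}(T_n(θ*) > 1/α) ≤ α, for every θ* ∈ Θ and every estimator θ̂₁ that is a measurable function of D₁. -/
open MeasureTheory
open scoped ENNReal

/-- The integral of a product of functions of the separate coordinates against a product of
probability measures is the product of the integrals. -/
theorem lintegral_pi_prod_eval {ι 𝒴 : Type*} [Fintype ι] [MeasurableSpace 𝒴]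
    (ν : ι → Measure 𝒴) [∀ i, IsProbabilityMeasure (ν i)]
    {f : ι → 𝒴 → ℝ≥0∞} (hf : ∀ i, Measurable (f i)) :
    ∫⁻ x, ∏ i, f i (x i) ∂(Measure.pi ν) = ∏ i, ∫⁻ y, f i y ∂(ν i) := by
  rw [ProbabilityTheory.lintegral_prod_eq_prod_lintegral_of_indepFun Finset.univ
    (fun i (x : ι → 𝒴) => f i (x i))
    (ProbabilityTheory.iIndepFun_pi fun i => (hf i).aemeasurable)
    (fun i => (hf i).comp (measurable_pi_apply i))]
  exact Finset.prod_congr rfl fun i _ => (measurePreserving_eval ν i).lintegral_comp (hf i)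

/-- Under the density `q`, the likelihood ratio `f / q` has expectation at most `∫ f`. -/
theorem lintegral_div_withDensity_le {𝒴 : Type*} [MeasurableSpace 𝒴] (μ : Measure 𝒴)
    {f q : 𝒴 → ℝ≥0∞} (hf : Measurable f) (hq : Measurable q) :
    ∫⁻ y, f y / q y ∂(μ.withDensity q) ≤ ∫⁻ y, f y ∂μ := by
  rw [lintegral_withDensity_eq_lintegral_mul μ hq (g := fun y => f y / q y)
    (hf.div hq)]
  exact lintegral_mono fun y => ENNReal.mul_div_le

/-- The likelihood ratio of an i.i.d. sample has expectation at most one under the law of the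
denominator. -/
theorem lintegral_likelihood_ratio_le_one {ι 𝒴 : Type*} [Fintype ι] [MeasurableSpace 𝒴]
    (μ : Measure 𝒴) {f q : 𝒴 → ℝ≥0∞} (hf : Measurable f) (hq : Measurable q)
    (hf1 : ∫⁻ y, f y ∂μ ≤ 1) (hq_top : ∫⁻ y, q y ∂μ ≠ ∞)
    [IsProbabilityMeasure (μ.withDensity q)] :
    ∫⁻ x, (∏ i, f (x i)) / (∏ i, q (x i)) ∂(Measure.pi fun _ : ι => μ.withDensity q) ≤ 1 := by
  have hfin : ∀ᵐ y ∂(μ.withDensity q), q y < ∞ :=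
    (withDensity_absolutelyContinuous μ q).ae_le (ae_lt_top hq hq_top)
  have hall : ∀ᵐ x ∂(Measure.pi fun _ : ι => μ.withDensity q), ∀ i, q (x i) < ∞ :=
    ae_all_iff.2 fun i =>
      (measurePreserving_eval (fun _ : ι => μ.withDensity q) i).quasiMeasurePreserving.ae hfin
  calc ∫⁻ x, (∏ i, f (x i)) / (∏ i, q (x i)) ∂(Measure.pi fun _ : ι => μ.withDensity q)
      = ∫⁻ x, ∏ i, f (x i) / q (x i) ∂(Measure.pi fun _ : ι => μ.withDensity q) := by
        refine lintegral_congr_ae ?_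
        filter_upwards [hall] with x hx
        exact (ENNReal.prod_div_distrib_of_ne_top fun i _ => (hx i).ne).symm
    _ = ∏ _i : ι, ∫⁻ y, f y / q y ∂(μ.withDensity q) :=
        lintegral_pi_prod_eval (fun _ : ι => μ.withDensity q) fun _ => hf.div hq
    _ ≤ 1 := Finset.prod_le_one' fun _ _ => (lintegral_div_withDensity_le μ hf hq).trans hf1

/-- Markov's inequality, as a lower bound on the probability of the complementary event. -/
theorem ofReal_one_sub_le_measure_le_of_lintegral_le_one {Ω : Type*} [MeasurableSpace Ω]
    (P : Measure Ω) [IsProbabilityMeasure P] {T : Ω → ℝ≥0∞} (hT : Measurable T)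
    (hT1 : ∫⁻ ω, T ω ∂P ≤ 1) {α : ℝ} (hα : 0 < α) :
    ENNReal.ofReal (1 - α) ≤ P {ω | T ω ≤ ENNReal.ofReal (1 / α)} := by
  have htail : P {ω | T ω ≤ ENNReal.ofReal (1 / α)}ᶜ ≤ ENNReal.ofReal α :=
    calc P {ω | T ω ≤ ENNReal.ofReal (1 / α)}ᶜ
        ≤ P {ω | ENNReal.ofReal (1 / α) ≤ T ω} :=
          measure_mono fun ω (hω : ¬ T ω ≤ ENNReal.ofReal (1 / α)) => (not_le.1 hω).le
      _ ≤ (∫⁻ ω, T ω ∂P) / ENNReal.ofReal (1 / α) :=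
          meas_ge_le_lintegral_div hT.aemeasurable
            (ENNReal.ofReal_pos.2 (one_div_pos.2 hα)).ne' ENNReal.ofReal_ne_top
      _ ≤ 1 / ENNReal.ofReal (1 / α) := by gcongr
      _ = ENNReal.ofReal α := by
          rw [one_div α, ENNReal.ofReal_inv_of_pos hα, one_div, inv_inv]
  have hmeas : MeasurableSet {ω | T ω ≤ ENNReal.ofReal (1 / α)} :=
    measurableSet_le hT measurable_const
  rw [← compl_compl {ω | T ω ≤ ENNReal.ofReal (1 / α)}, prob_compl_eq_one_sub hmeas.compl,
    ENNReal.ofReal_sub 1 hα.le, ENNReal.ofReal_one]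
  exact tsub_le_tsub_left htail 1

/-- **Theorem 1, split version.** The universal (split LRT) confidence set
`Cₙ = {θ : Tₙ(θ) ≤ 1/α}`, with `Tₙ(θ) = L₀(θ̂₁)/L₀(θ)` where `L₀` is the likelihood on
`D₀ = ω.1` and `θ̂₁` is any measurable estimator based on `D₁ = ω.2`, satisfies
`P_{θ*}(θ* ∈ Cₙ) ≥ 1 − α`.  The data `Y₁, …, Y₂ₙ` are i.i.d. with density `p θ*`,
modeled by the product measure on `(Fin n → 𝒴) × (Fin n → 𝒴)`. -/
theorem universal_confidence_set_coverage
    {𝒴 Θ : Type*} [MeasurableSpace 𝒴] [MeasurableSpace Θ]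
    (μ : Measure 𝒴) [SigmaFinite μ] (n : ℕ)
    (p : Θ → 𝒴 → ℝ≥0∞) (hp_meas : Measurable (Function.uncurry p))
    (hp1 : ∀ θ, ∫⁻ y, p θ y ∂μ = 1)
    [∀ θ, IsProbabilityMeasure (μ.withDensity (p θ))]
    (θstar : Θ) (hat1 : (Fin n → 𝒴) → Θ) (hhat1 : Measurable hat1)
    (α : ℝ) (hα : α ∈ Set.Ioo (0 : ℝ) 1) :
    ENNReal.ofReal (1 - α) ≤
      ((Measure.pi fun _ : Fin n => μ.withDensity (p θstar)).prod
        (Measure.pi fun _ : Fin n => μ.withDensity (p θstar)))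
        {ω : (Fin n → 𝒴) × (Fin n → 𝒴) |
          (∏ i, p (hat1 ω.2) (ω.1 i)) / (∏ i, p θstar (ω.1 i)) ≤ ENNReal.ofReal (1 / α)} := by
  have hp : ∀ θ, Measurable (p θ) := fun θ => hp_meas.of_uncurry_left
  have hT : Measurable fun ω : (Fin n → 𝒴) × (Fin n → 𝒴) =>
      (∏ i, p (hat1 ω.2) (ω.1 i)) / (∏ i, p θstar (ω.1 i)) := by
    refine Measurable.div (Finset.measurable_prod _ fun i _ => ?_)
      (Finset.measurable_prod _ fun i _ => ?_)
    · exact hp_meas.comp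
        ((hhat1.comp measurable_snd).prodMk ((measurable_pi_apply i).comp measurable_fst))
    · exact (hp θstar).comp ((measurable_pi_apply i).comp measurable_fst)
  refine ofReal_one_sub_le_measure_le_of_lintegral_le_one _ hT ?_ hα.1
  rw [lintegral_prod_symm' _ hT]
  calc _ ≤ ∫⁻ _, 1 ∂(Measure.pi fun _ : Fin n => μ.withDensity (p θstar)) :=
        lintegral_mono fun y => lintegral_likelihood_ratio_le_one μ (hp (hat1 y)) (hp θstar)
          (hp1 _).le (by simp [hp1])
    _ = 1 := by simp
end

section
/- (Theorem 2, split LRT) Let Θ₀ ⊆ Θ be a null set and let θ̂₀ be any random element of Θ₀, measurable with respect to D₀, satisfying L₀(θ̂₀) ≥ L₀(θ) for all θ ∈ Θ₀ (e.g., the null maximum likelihood estimator on D₀). Define U_n = L₀(θ̂₁)/L₀(θ̂₀). Then the split LRT, which rejects H₀ when U_n > 1/α, controls the type I error: sup_{θ* ∈ Θ₀} P_{θ*}(U_n > 1/α) ≤ α for any α ∈ (0,1). -/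
open MeasureTheory
open scoped ENNReal

/-- The expected likelihood ratio of `f` against `g` is at most one under i.i.d. sampling from the
density `g`. -/
theorem lintegral_pi_likelihood_ratio_le_one {ι 𝒴 : Type*} [Fintype ι] [MeasurableSpace 𝒴]
    (μ : Measure 𝒴) {f g : 𝒴 → ℝ≥0∞} (hf : Measurable f) (hg : Measurable g)
    (hf1 : ∫⁻ y, f y ∂μ = 1) [IsProbabilityMeasure (μ.withDensity g)] :
    ∫⁻ d, (∏ i, f (d i)) / (∏ i, g (d i)) ∂(Measure.pi fun _ : ι => μ.withDensity g) ≤ 1 := by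
  have hne : ∀ᵐ y ∂μ.withDensity g, g y ≠ 0 :=
    (ae_withDensity_iff hg).2 <| ae_of_all _ fun _ h => h
  have hne_pi : ∀ᵐ d ∂(Measure.pi fun _ : ι => μ.withDensity g), ∀ i, g (d i) ≠ 0 :=
    ae_all_iff.2 fun i =>
      (measurePreserving_eval (fun _ : ι => μ.withDensity g) i).quasiMeasurePreserving.ae hne
  have hratio : ∫⁻ y, f y / g y ∂(μ.withDensity g) ≤ 1 := by
    rw [← hf1]
    refine (lintegral_withDensity_le_lintegral_mul μ hg _).trans (lintegral_mono fun y => ?_)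
    exact ENNReal.mul_div_le
  have hindep := ProbabilityTheory.iIndepFun_pi (μ := fun _ : ι => μ.withDensity g)
    (X := fun _ y => f y / g y) fun _ => (hf.div hg).aemeasurable
  calc
    _ = ∫⁻ d, ∏ i, f (d i) / g (d i) ∂(Measure.pi fun _ : ι => μ.withDensity g) := by
      refine lintegral_congr_ae ?_
      filter_upwards [hne_pi] with d hd
      exact (ENNReal.prod_div_distrib fun i _ _ _ _ => Or.inl (hd i)).symm
    _ = ∏ i, ∫⁻ d, f (d i) / g (d i) ∂(Measure.pi fun _ : ι => μ.withDensity g) :=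
      ProbabilityTheory.lintegral_prod_eq_prod_lintegral_of_indepFun Finset.univ _ hindep
        fun i => (hf.div hg).comp (measurable_pi_apply i)
    _ ≤ 1 := by
      refine Finset.prod_le_one' fun i _ => ?_
      rwa [(measurePreserving_eval (fun _ : ι => μ.withDensity g) i).lintegral_comp
        (f := fun y => f y / g y) (hf.div hg)]

/-- **Theorem 2, split LRT.** Let `Θ₀ ⊆ Θ` be a composite null and let
`θ̂₀ = mle0 D₀ ∈ Θ₀` be measurable in `D₀` and maximize the `D₀`-likelihood over `Θ₀`.
With `θ̂₁ = hat1 D₁` any estimator measurable in `D₁` and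
`Uₙ = L₀(θ̂₁)/L₀(θ̂₀)`, the split LRT that rejects when `Uₙ > 1/α` has type I error at
most `α`: for every `θ* ∈ Θ₀`, `P_{θ*}(Uₙ > 1/α) ≤ α`. -/
theorem split_LRT_type_I_error
    {𝒴 Θ : Type*} [MeasurableSpace 𝒴] [MeasurableSpace Θ]
    (μ : Measure 𝒴) [SigmaFinite μ] (n : ℕ)
    (p : Θ → 𝒴 → ℝ≥0∞) (hp_meas : Measurable (Function.uncurry p))
    (hp1 : ∀ θ, ∫⁻ y, p θ y ∂μ = 1)
    [∀ θ, IsProbabilityMeasure (μ.withDensity (p θ))]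
    (Θ₀ : Set Θ)
    (hat1 : (Fin n → 𝒴) → Θ) (hhat1 : Measurable hat1)
    (mle0 : (Fin n → 𝒴) → Θ) (hmle0_meas : Measurable mle0)
    (hmle0_mem : ∀ d : Fin n → 𝒴, mle0 d ∈ Θ₀)
    (hmle0_max : ∀ d : Fin n → 𝒴, ∀ θ ∈ Θ₀, (∏ i, p θ (d i)) ≤ ∏ i, p (mle0 d) (d i))
    (θstar : Θ) (hθstar : θstar ∈ Θ₀)
    (α : ℝ) (hα : α ∈ Set.Ioo (0 : ℝ) 1) :
    ((Measure.pi fun _ : Fin n => μ.withDensity (p θstar)).prod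
        (Measure.pi fun _ : Fin n => μ.withDensity (p θstar)))
        {ω : (Fin n → 𝒴) × (Fin n → 𝒴) |
          ENNReal.ofReal (1 / α) <
            (∏ i, p (hat1 ω.2) (ω.1 i)) / (∏ i, p (mle0 ω.1) (ω.1 i))}
      ≤ ENNReal.ofReal α := by
  obtain ⟨hα0, -⟩ := hα
  have hp : ∀ θ, Measurable (p θ) := fun θ => hp_meas.of_uncurry_left
  set P := Measure.pi fun _ : Fin n => μ.withDensity (p θstar)
  have hmeas : Measurable fun ω : (Fin n → 𝒴) × (Fin n → 𝒴) =>
      (∏ i, p (hat1 ω.2) (ω.1 i)) / (∏ i, p θstar (ω.1 i)) := by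
    refine (Finset.measurable_prod _ fun i _ => ?_).div (Finset.measurable_prod _ fun i _ => ?_)
    · exact hp_meas.comp ((hhat1.comp measurable_snd).prodMk
        ((measurable_pi_apply i).comp measurable_fst))
    · exact (hp θstar).comp ((measurable_pi_apply i).comp measurable_fst)
  calc
    _ ≤ (P.prod P) {ω | ENNReal.ofReal (1 / α) ≤
          (∏ i, p (hat1 ω.2) (ω.1 i)) / (∏ i, p θstar (ω.1 i))} :=
      measure_mono fun ω hω =>
        hω.le.trans (ENNReal.div_le_div_left (hmle0_max ω.1 θstar hθstar) _)
    _ ≤ (∫⁻ ω, (∏ i, p (hat1 ω.2) (ω.1 i)) / (∏ i, p θstar (ω.1 i)) ∂P.prod P) /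
          ENNReal.ofReal (1 / α) :=
      meas_ge_le_lintegral_div hmeas.aemeasurable
        (ENNReal.ofReal_pos.2 (one_div_pos.2 hα0)).ne' ENNReal.ofReal_ne_top
    _ ≤ 1 / ENNReal.ofReal (1 / α) := by
      gcongr
      rw [lintegral_prod_symm' _ hmeas]
      refine (lintegral_mono fun d => lintegral_pi_likelihood_ratio_le_one μ (hp (hat1 d))
        (hp θstar) (hp1 _)).trans ?_
      simp
    _ = ENNReal.ofReal α := by
      rw [one_div α, ENNReal.ofReal_inv_of_pos hα0, one_div, inv_inv]
end

section
/- (Model selection with sieves) Let 𝒫₁ ⊂ 𝒫₂ ⊂ ⋯ be a nested sequence of collections of probability densities with respect to μ, and suppose the true density p* generating the i.i.d. data satisfies p* ∈ 𝒫_{j₀} for some minimal index j₀. For each j, reject H_j: p* ∈ 𝒫_j if ∏_{i∈D₀} p̂_{j+1}(Yᵢ)/p̂_j(Yᵢ) > 1/α, where p̂_{j+1} ∈ 𝒫_{j+1} is any measurable function of D₁ and p̂_j maximizes ∏_{i∈D₀} p(Yᵢ) over p ∈ 𝒫_j. Let ĵ be the first index j such that H_j is not rejected. Then P_{p*}(p*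 ∈ 𝒫_{ĵ−1}) ≤ α, i.e., with probability at least 1 − α the selected index satisfies ĵ ≤ j₀, without any correction for testing multiple hypotheses. -/
open MeasureTheory
open scoped ENNReal

namespace MeasureTheory

/-- **Tonelli's theorem** for products of functions of separate coordinates. -/
theorem lintegral_pi_prod_eq_prod {ι : Type*} [Fintype ι] {X : ι → Type*}
    [∀ i, MeasurableSpace (X i)] (ν : ∀ i, Measure (X i)) [∀ i, IsProbabilityMeasure (ν i)]
    {f : ∀ i, X i → ℝ≥0∞} (hf : ∀ i, Measurable (f i)) :
    ∫⁻ x, ∏ i, f i (x i) ∂(Measure.pi ν) = ∏ i, ∫⁻ y, f i y ∂(ν i) := by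
  rw [ProbabilityTheory.lintegral_prod_eq_prod_lintegral_of_indepFun Finset.univ
    (fun i (x : ∀ i, X i) => f i (x i)) (ProbabilityTheory.iIndepFun_pi fun i => (hf i).aemeasurable)
    fun i => (hf i).comp (measurable_pi_apply i)]
  exact Finset.prod_congr rfl fun i _ => (measurePreserving_eval ν i).lintegral_comp (hf i)

theorem lintegral_div_withDensity_le {X : Type*} [MeasurableSpace X] (μ : Measure X)
    {p q : X → ℝ≥0∞} (hp : Measurable p) (hq : Measurable q) :
    ∫⁻ y, q y / p y ∂(μ.withDensity p) ≤ ∫⁻ y, q y ∂μ := by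
  rw [lintegral_withDensity_eq_lintegral_mul μ hp (g := fun y => q y / p y) (hq.div hp)]
  exact lintegral_mono fun _ => ENNReal.mul_div_le

theorem ae_withDensity_ne_zero {X : Type*} [MeasurableSpace X] (μ : Measure X)
    {p : X → ℝ≥0∞} (hp : Measurable p) : ∀ᵐ y ∂(μ.withDensity p), p y ≠ 0 :=
  (ae_withDensity_iff hp).2 (Filter.Eventually.of_forall fun _ h => h)

theorem measurable_prod_div {X Z : Type*} [MeasurableSpace X] [MeasurableSpace Z]
    {ι : Type*} [Fintype ι] {p : X → ℝ≥0∞} (hp : Measurable p)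
    {q : Z → X → ℝ≥0∞} (hq : Measurable fun x : Z × X => q x.1 x.2) :
    Measurable fun ω : (ι → X) × Z => ∏ i, q ω.2 (ω.1 i) / p (ω.1 i) := by
  refine Finset.measurable_prod _ fun i _ => ?_
  have hi : Measurable fun ω : (ι → X) × Z => ω.1 i := by fun_prop
  exact (hq.comp (measurable_snd.prodMk hi)).div (hp.comp hi)

/-- The split likelihood ratio of an estimator built on independent data has expectation
at most one. -/
theorem lintegral_prod_div_le_one {X Z : Type*} [MeasurableSpace X] [MeasurableSpace Z]
    {ι : Type*} [Fintype ι] (μ : Measure X) {p : X → ℝ≥0∞} (hp : Measurable p)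
    [IsProbabilityMeasure (μ.withDensity p)] (ρ : Measure Z) [IsProbabilityMeasure ρ]
    {q : Z → X → ℝ≥0∞} (hq : Measurable fun x : Z × X => q x.1 x.2)
    (hq_le : ∀ z, ∫⁻ y, q z y ∂μ ≤ 1) :
    ∫⁻ ω, ∏ i, q ω.2 (ω.1 i) / p (ω.1 i)
      ∂((Measure.pi fun _ : ι => μ.withDensity p).prod ρ) ≤ 1 := by
  rw [lintegral_prod_symm' _ (measurable_prod_div hp hq)]
  calc
    _ ≤ ∫⁻ _, 1 ∂ρ := by
      refine lintegral_mono fun z => ?_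
      have hqz : Measurable (q z) := hq.comp measurable_prodMk_left
      rw [lintegral_pi_prod_eq_prod (fun _ : ι => μ.withDensity p)
        (f := fun _ y => q z y / p y) fun _ => hqz.div hp]
      exact Finset.prod_le_one' fun _ _ =>
        (lintegral_div_withDensity_le μ hp hqz).trans (hq_le z)
    _ = 1 := by simp

/-- The split likelihood ratio test against the true density has level `α`. -/
theorem measure_le_prod_div_prod_le {X Z : Type*} [MeasurableSpace X] [MeasurableSpace Z]
    {ι : Type*} [Fintype ι] (μ : Measure X) {p : X → ℝ≥0∞} (hp : Measurable p)
    [IsProbabilityMeasure (μ.withDensity p)] (ρ : Measure Z) [IsProbabilityMeasure ρ]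
    {q : Z → X → ℝ≥0∞} (hq : Measurable fun x : Z × X => q x.1 x.2)
    (hq_le : ∀ z, ∫⁻ y, q z y ∂μ ≤ 1) {α : ℝ} (hα : 0 < α) :
    ((Measure.pi fun _ : ι => μ.withDensity p).prod ρ)
        {ω | ENNReal.ofReal (1 / α) ≤ (∏ i, q ω.2 (ω.1 i)) / ∏ i, p (ω.1 i)}
      ≤ ENNReal.ofReal α := by
  have hpos : ∀ᵐ ω ∂((Measure.pi fun _ : ι => μ.withDensity p).prod ρ),
      ∀ i, p (ω.1 i) ≠ 0 :=
    Measure.quasiMeasurePreserving_fst.ae <| ae_all_iff.2 fun i =>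
      (Measure.quasiMeasurePreserving_eval (fun _ : ι => μ.withDensity p) i).ae
        (ae_withDensity_ne_zero μ hp)
  have hratio : (fun ω : (ι → X) × Z => ∏ i, q ω.2 (ω.1 i) / p (ω.1 i))
      =ᵐ[(Measure.pi fun _ : ι => μ.withDensity p).prod ρ]
      fun ω => (∏ i, q ω.2 (ω.1 i)) / ∏ i, p (ω.1 i) := by
    filter_upwards [hpos] with ω hω
    exact ENNReal.prod_div_distrib fun i _ _ _ _ => Or.inl (hω i)
  calc
    _ ≤ _ := meas_ge_le_lintegral_div ((measurable_prod_div hp hq).aemeasurable.congr hratio)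
      (by simpa using hα) ENNReal.ofReal_ne_top
    _ ≤ 1 / ENNReal.ofReal (1 / α) := by
      rw [← lintegral_congr_ae hratio]
      exact ENNReal.div_le_div_right (lintegral_prod_div_le_one μ hp ρ hq hq_le) _
    _ = ENNReal.ofReal α := by
      rw [one_div, one_div, ENNReal.ofReal_inv_of_pos hα, inv_inv]

end MeasureTheory

/-- **Model selection with sieves.** Let `Mod 1 ⊆ Mod 2 ⊆ ⋯` be a sieve of
models of probability densities (indices start at `1`; we set `Mod 0 = ∅`), and let the
true density satisfy `p* ∈ Mod j₀` with `j₀` minimal.  For each `j`, hypothesis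
`H_j : p* ∈ Mod j` is rejected when `∏_{i∈D₀} p̂_{j+1}(Yᵢ)/p̂_j(Yᵢ) > 1/α`, where
`p̂_{j+1} = est j D₁ ∈ Mod (j+1)` is any estimator measurable in `D₁` and
`p̂_j = mle j D₀` maximizes the `D₀`-likelihood over `Mod j`.  With
`ĵ` the first index `j ≥ 1` at which `H_j` is not rejected, the selection error satisfies
`P_{p*}(p* ∈ Mod (ĵ − 1)) ≤ α`, without any multiple-testing correction. -/
theorem sieve_model_selection_error
    {𝒴 : Type*} [MeasurableSpace 𝒴] (μ : Measure 𝒴) [SigmaFinite μ] (n : ℕ)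
    (Mod : ℕ → Set (𝒴 → ℝ≥0∞))
    (hnested : ∀ j, Mod j ⊆ Mod (j + 1))
    (h0 : Mod 0 = ∅)
    (hdens : ∀ j, ∀ p ∈ Mod j, Measurable p ∧ ∫⁻ y, p y ∂μ = 1)
    (pstar : 𝒴 → ℝ≥0∞) (hpstar_meas : Measurable pstar)
    [IsProbabilityMeasure (μ.withDensity pstar)]
    (j₀ : ℕ) (hj₀ : pstar ∈ Mod j₀) (hj₀min : ∀ j < j₀, pstar ∉ Mod j)
    (est : ℕ → (Fin n → 𝒴) → 𝒴 → ℝ≥0∞)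
    (hest_mem : ∀ j, ∀ d : Fin n → 𝒴, est j d ∈ Mod (j + 1))
    (hest_meas : ∀ j, Measurable (fun x : (Fin n → 𝒴) × 𝒴 => est j x.1 x.2))
    (mle : ℕ → (Fin n → 𝒴) → 𝒴 → ℝ≥0∞)
    (hmle_mem : ∀ j, 1 ≤ j → ∀ d : Fin n → 𝒴, mle j d ∈ Mod j)
    (hmle_max : ∀ j, ∀ d : Fin n → 𝒴, ∀ q ∈ Mod j, (∏ i, q (d i)) ≤ ∏ i, mle j d (d i))
    (α : ℝ) (hα : α ∈ Set.Ioo (0 : ℝ) 1) :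
    ((Measure.pi fun _ : Fin n => μ.withDensity pstar).prod
        (Measure.pi fun _ : Fin n => μ.withDensity pstar))
        {ω : (Fin n → 𝒴) × (Fin n → 𝒴) |
          pstar ∈ Mod ((sInf {j : ℕ | 1 ≤ j ∧
            (∏ i, est j ω.2 (ω.1 i)) / (∏ i, mle j ω.1 (ω.1 i)) ≤ ENNReal.ofReal (1 / α)})
            - 1)}
      ≤ ENNReal.ofReal α := by
  refine (measure_mono fun ω hω => ?_).trans (measure_le_prod_div_prod_le μ hpstar_meas _
    (hest_meas j₀) (fun z => (hdens _ _ (hest_mem j₀ z)).2.le) hα.1)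
  have hj₀_pos : 1 ≤ j₀ := by
    rw [Nat.one_le_iff_ne_zero]
    rintro rfl
    simp [h0] at hj₀
  have hle := not_lt.1 fun h => hj₀min _ h hω
  have hnot := Nat.notMem_of_lt_sInf (show j₀ < sInf {j : ℕ | 1 ≤ j ∧
    (∏ i, est j ω.2 (ω.1 i)) / (∏ i, mle j ω.1 (ω.1 i)) ≤ ENNReal.ofReal (1 / α)} by omega)
  have hrej := not_le.1 fun h => hnot ⟨hj₀_pos, h⟩
  exact hrej.le.trans (ENNReal.div_le_div_left (hmle_max j₀ ω.1 pstar hj₀) _)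
end

section
/- (Relaxed likelihood test) Let Θ₀ ⊆ Θ and let V be any random variable, measurable with respect to D₀, satisfying V ≥ sup_{θ ∈ Θ₀} L₀(θ) almost surely (e.g., the optimal value of a convex relaxation upper bounding the null maximum likelihood). Define T_n' = L₀(θ̂₁)/V. Then the test that rejects H₀: θ* ∈ Θ₀ when T_n' > 1/α satisfies sup_{θ* ∈ Θ₀} P_{θ*}(T_n' > 1/α) ≤ α for any α ∈ (0,1). -/
open MeasureTheory
open scoped ENNReal

/-- The expected value of a product of likelihood ratios under the product of the
reference densities is at most one. -/
theorem lintegral_pi_prod_div_le_one {ι 𝒴 : Type*} [Fintype ι] [MeasurableSpace 𝒴]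
    {μ : Measure 𝒴} {f g : 𝒴 → ℝ≥0∞} (hf : Measurable f) (hg : Measurable g)
    [IsProbabilityMeasure (μ.withDensity f)] (hg1 : ∫⁻ y, g y ∂μ ≤ 1) :
    ∫⁻ y : ι → 𝒴, ∏ i, g (y i) / f (y i) ∂(Measure.pi fun _ => μ.withDensity f) ≤ 1 := by
  have hind : ProbabilityTheory.iIndepFun (fun i (y : ι → 𝒴) => g (y i) / f (y i))
      (Measure.pi fun _ => μ.withDensity f) :=
    ProbabilityTheory.iIndepFun_pi (X := fun _ y => g y / f y)
      fun _ => (hg.div hf).aemeasurable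
  rw [ProbabilityTheory.lintegral_prod_eq_prod_lintegral_of_indepFun _ _ hind
    fun i => (hg.div hf).comp (measurable_pi_apply i)]
  refine Finset.prod_le_one' fun i _ => ?_
  calc
    _ = ∫⁻ y, g y / f y ∂(μ.withDensity f) :=
      (measurePreserving_eval (fun _ : ι => μ.withDensity f) i).lintegral_comp (hg.div hf)
    _ = ∫⁻ y, f y * (g y / f y) ∂μ :=
      lintegral_withDensity_eq_lintegral_mul _ hf (hg.div hf)
    _ ≤ ∫⁻ y, g y ∂μ := lintegral_mono fun y => ENNReal.mul_div_le
    _ ≤ 1 := hg1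

/-- Under the product of the reference densities, the quotient of the products is almost surely
the product of the quotients. -/
theorem ae_pi_prod_div_prod_eq {ι 𝒴 : Type*} [Fintype ι] [MeasurableSpace 𝒴]
    {μ : Measure 𝒴} {f : 𝒴 → ℝ≥0∞} (hf : Measurable f)
    [IsProbabilityMeasure (μ.withDensity f)] :
    ∀ᵐ y : ι → 𝒴 ∂(Measure.pi fun _ => μ.withDensity f), ∀ a : ι → ℝ≥0∞,
      (∏ i, a i) / ∏ i, f (y i) = ∏ i, a i / f (y i) := by
  have hne : ∀ᵐ y ∂(μ.withDensity f), f y ≠ 0 :=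
    (ae_withDensity_iff hf).2 (ae_of_all _ fun _ h => h)
  have hall : ∀ᵐ y : ι → 𝒴 ∂(Measure.pi fun _ => μ.withDensity f), ∀ i, f (y i) ≠ 0 :=
    ae_all_iff.2 fun i =>
      (Measure.quasiMeasurePreserving_eval (fun _ : ι => μ.withDensity f) i).ae hne
  filter_upwards [hall] with y hy a
  exact (ENNReal.prod_div_distrib_of_ne_zero fun i _ => hy i).symm

/-- **Relaxed likelihood test.** Let `Θ₀ ⊆ Θ` and let `V = V D₀` be any
random variable, measurable with respect to `D₀`, satisfying
`V ≥ sup_{θ ∈ Θ₀} L₀(θ)` almost surely (e.g. the optimal value of a convex relaxation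
upper bounding the null maximum likelihood).  Then the test rejecting `H₀ : θ* ∈ Θ₀` when
`Tₙ' = L₀(θ̂₁)/V > 1/α` satisfies `P_{θ*}(Tₙ' > 1/α) ≤ α` for every `θ* ∈ Θ₀`. -/
theorem relaxed_likelihood_test_type_I_error
    {𝒴 Θ : Type*} [MeasurableSpace 𝒴] [MeasurableSpace Θ]
    (μ : Measure 𝒴) [SigmaFinite μ] (n : ℕ)
    (p : Θ → 𝒴 → ℝ≥0∞) (hp_meas : Measurable (Function.uncurry p))
    (hp1 : ∀ θ, ∫⁻ y, p θ y ∂μ = 1)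
    [∀ θ, IsProbabilityMeasure (μ.withDensity (p θ))]
    (Θ₀ : Set Θ) (θstar : Θ) (hθstar : θstar ∈ Θ₀)
    (hat1 : (Fin n → 𝒴) → Θ) (hhat1 : Measurable hat1)
    (V : (Fin n → 𝒴) → ℝ≥0∞) (hV_meas : Measurable V)
    (hV : ∀ᵐ ω : (Fin n → 𝒴) × (Fin n → 𝒴)
        ∂((Measure.pi fun _ : Fin n => μ.withDensity (p θstar)).prod
          (Measure.pi fun _ : Fin n => μ.withDensity (p θstar))),
        (⨆ θ ∈ Θ₀, ∏ i, p θ (ω.1 i)) ≤ V ω.1)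
    (α : ℝ) (hα : α ∈ Set.Ioo (0 : ℝ) 1) :
    ((Measure.pi fun _ : Fin n => μ.withDensity (p θstar)).prod
        (Measure.pi fun _ : Fin n => μ.withDensity (p θstar)))
        {ω : (Fin n → 𝒴) × (Fin n → 𝒴) |
          ENNReal.ofReal (1 / α) < (∏ i, p (hat1 ω.2) (ω.1 i)) / V ω.1}
      ≤ ENNReal.ofReal α := by
  have hp (θ : Θ) : Measurable (p θ) := hp_meas.of_uncurry_left
  set P := Measure.pi fun _ : Fin n => μ.withDensity (p θstar)
  have hL : Measurable fun ω : (Fin n → 𝒴) × (Fin n → 𝒴) => ∏ i, p (hat1 ω.2) (ω.1 i) :=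
    Finset.measurable_fun_prod _ fun i _ =>
      hp_meas.comp ((hhat1.comp measurable_snd).prodMk
        ((measurable_pi_apply i).comp measurable_fst))
  have hR : Measurable fun ω : (Fin n → 𝒴) × (Fin n → 𝒴) =>
      ∏ i, p (hat1 ω.2) (ω.1 i) / p θstar (ω.1 i) :=
    Finset.measurable_fun_prod _ fun i _ =>
      (hp_meas.comp ((hhat1.comp measurable_snd).prodMk
        ((measurable_pi_apply i).comp measurable_fst))).div
        ((hp θstar).comp ((measurable_pi_apply i).comp measurable_fst))
  have hE : ∫⁻ ω, (∏ i, p (hat1 ω.2) (ω.1 i)) / V ω.1 ∂(P.prod P) ≤ 1 := calc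
    _ ≤ ∫⁻ ω, ∏ i, p (hat1 ω.2) (ω.1 i) / p θstar (ω.1 i) ∂(P.prod P) := by
      refine lintegral_mono_ae ?_
      filter_upwards [hV, Measure.quasiMeasurePreserving_fst.ae
        (ae_pi_prod_div_prod_eq (ι := Fin n) (hp θstar))] with ω hω hdiv
      rw [← hdiv fun i => p (hat1 ω.2) (ω.1 i)]
      exact ENNReal.div_le_div_left
        ((le_iSup₂ (f := fun θ (_ : θ ∈ Θ₀) => ∏ i, p θ (ω.1 i)) θstar hθstar).trans hω) _
    _ = ∫⁻ y₁, ∫⁻ y₀, ∏ i, p (hat1 y₁) (y₀ i) / p θstar (y₀ i) ∂P ∂P :=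
      lintegral_prod_symm _ hR.aemeasurable
    _ ≤ ∫⁻ _, 1 ∂P :=
      lintegral_mono fun y₁ => lintegral_pi_prod_div_le_one (hp θstar) (hp _) (hp1 _).le
    _ = 1 := by simp [P]
  have hα0 : 0 < 1 / α := one_div_pos.2 hα.1
  calc (P.prod P) {ω | ENNReal.ofReal (1 / α) < (∏ i, p (hat1 ω.2) (ω.1 i)) / V ω.1}
    _ ≤ (P.prod P) {ω | ENNReal.ofReal (1 / α) ≤ (∏ i, p (hat1 ω.2) (ω.1 i)) / V ω.1} :=
      measure_mono (Set.ofPred_subset_ofPred.2 fun _ => le_of_lt)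
    _ ≤ (∫⁻ ω, (∏ i, p (hat1 ω.2) (ω.1 i)) / V ω.1 ∂(P.prod P)) / ENNReal.ofReal (1 / α) :=
      meas_ge_le_lintegral_div (hL.div (hV_meas.comp measurable_fst)).aemeasurable
        (ENNReal.ofReal_pos.2 hα0).ne' ENNReal.ofReal_ne_top
    _ ≤ 1 / ENNReal.ofReal (1 / α) := ENNReal.div_le_div_right hE _
    _ = ENNReal.ofReal α := by
      rw [one_div, one_div, ← ENNReal.ofReal_inv_of_pos (inv_pos.2 hα.1), inv_inv]
end

section
/- (Powered likelihood) Fix η ∈ (0,1). For any θ ∈ Θ and any estimator θ̂₁ measurable with respect to D₁, E_{θ*}[(L₀(θ̂₁)/L₀(θ*))^η | D₁] = ∏_{i∈D₀} ∫ p_{θ̂₁}^η(y) p_{θ*}^{1−η}(y) dμ(y) ≤ 1. Consequently, the powered split LRT that rejects H₀: θ* ∈ Θ₀ when (L₀(θ̂₁)/L₀(θ̂₀))^η > 1/α, with θ̂₀ the null maximum likelihood estimator on D₀, satisfies sup_{θ* ∈ Θ₀} P_{θ*}((L₀(θ̂₁)/L₀(θ̂₀))^η > 1/α) ≤ α. 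-/
open MeasureTheory
open scoped ENNReal

/-- The integral of a product of functions of the separate coordinates against a finite product of
probability measures is the product of the integrals. -/
theorem lintegral_pi_prod_eq_prod {ι : Type*} [Fintype ι] {X : Type*} [MeasurableSpace X]
    (ν : Measure X) [IsProbabilityMeasure ν] {f : X → ℝ≥0∞} (hf : Measurable f) :
    ∫⁻ x : ι → X, ∏ i, f (x i) ∂(Measure.pi fun _ => ν) = ∏ _i : ι, ∫⁻ y, f y ∂ν := by
  have h := ProbabilityTheory.lintegral_prod_eq_prod_lintegral_of_indepFun
    (μ := Measure.pi fun _ : ι => ν) Finset.univ (fun i (x : ι → X) => f (x i))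
    (ProbabilityTheory.iIndepFun_pi fun _ => hf.aemeasurable)
    (fun i => hf.comp (measurable_pi_apply i))
  rw [h]
  refine Finset.prod_congr rfl fun i _ => ?_
  exact (measurePreserving_eval (fun _ : ι => ν) i).lintegral_comp hf

/-- Multiplying a power of a ratio by the denominator of the ratio. -/
theorem ENNReal.div_rpow_mul_self {a b : ℝ≥0∞} (hb : b ≠ ∞) {η : ℝ} (hη0 : 0 ≤ η) (hη1 : η < 1) :
    (a / b) ^ η * b = a ^ η * b ^ (1 - η) := by
  rcases eq_or_ne b 0 with rfl | hb0
  · simp [ENNReal.zero_rpow_of_pos (sub_pos.2 hη1)]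
  · rw [ENNReal.div_rpow_of_nonneg _ _ hη0, ENNReal.rpow_sub _ _ hb0 hb, ENNReal.rpow_one,
      div_eq_mul_inv, div_eq_mul_inv, mul_assoc, mul_comm _ b]

/-- The `η`-powered likelihood ratio of an i.i.d. sample with density `q` integrates to the product
of the Hellinger-type affinities `∫ r ^ η * q ^ (1 - η)`. -/
theorem lintegral_pi_likelihood_ratio_rpow {ι : Type*} [Fintype ι] {X : Type*} [MeasurableSpace X]
    (μ : Measure X) {q r : X → ℝ≥0∞} (hq : Measurable q) (hr : Measurable r)
    (hq_top : ∫⁻ y, q y ∂μ ≠ ∞) [IsProbabilityMeasure (μ.withDensity q)]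
    {η : ℝ} (hη0 : 0 ≤ η) (hη1 : η < 1) :
    ∫⁻ x : ι → X, ((∏ i, r (x i)) / ∏ i, q (x i)) ^ η ∂(Measure.pi fun _ => μ.withDensity q)
      = ∏ _i : ι, ∫⁻ y, r y ^ η * q y ^ (1 - η) ∂μ := by
  have hq_fin : ∀ᵐ y ∂μ, q y ≠ ∞ := (ae_lt_top hq hq_top).mono fun _ h => h.ne
  have hae : ∀ᵐ x ∂(Measure.pi fun _ : ι => μ.withDensity q), ∀ i, q (x i) ≠ ∞ :=
    ae_all_iff.2 fun i =>
      (measurePreserving_eval (fun _ : ι => μ.withDensity q) i).quasiMeasurePreserving.ae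
        (p := fun y => q y ≠ ∞) ((withDensity_absolutelyContinuous μ q).ae_le hq_fin)
  calc ∫⁻ x : ι → X, ((∏ i, r (x i)) / ∏ i, q (x i)) ^ η ∂(Measure.pi fun _ => μ.withDensity q)
      = ∫⁻ x : ι → X, ∏ i, (r (x i) / q (x i)) ^ η ∂(Measure.pi fun _ => μ.withDensity q) := by
        refine lintegral_congr_ae (hae.mono fun x hx => ?_)
        dsimp only
        rw [ENNReal.prod_rpow_of_nonneg hη0,
          ENNReal.prod_div_distrib_of_ne_top fun i _ => hx i]
    _ = ∏ _i : ι, ∫⁻ y, (r y / q y) ^ η ∂(μ.withDensity q) :=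
        lintegral_pi_prod_eq_prod _ ((hr.div hq).pow_const η)
    _ = ∏ _i : ι, ∫⁻ y, r y ^ η * q y ^ (1 - η) ∂μ := by
        refine Finset.prod_congr rfl fun i _ => ?_
        rw [lintegral_withDensity_eq_lintegral_mul (g := fun y => (r y / q y) ^ η) _ hq
          ((hr.div hq).pow_const η)]
        refine lintegral_congr_ae (hq_fin.mono fun y hy => ?_)
        simp only [Pi.mul_apply]
        rw [mul_comm, ENNReal.div_rpow_mul_self hy hη0 hη1]

/-- **Powered likelihood.** Fix `η ∈ (0,1)`.  For any estimator
`θ̂₁ = hat1 D₁` measurable in `D₁`, conditionally on `D₁` (i.e. for each fixed value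
`d₁` of `D₁`),
`E_{θ*}[(L₀(θ̂₁)/L₀(θ*))^η ∣ D₁ = d₁] = ∏_{i∈D₀} ∫ p_{θ̂₁}^η p_{θ*}^{1−η} dμ ≤ 1`.
Consequently the powered split LRT, rejecting `H₀ : θ* ∈ Θ₀` when
`(L₀(θ̂₁)/L₀(θ̂₀))^η > 1/α` with `θ̂₀ = mle0 D₀` the null MLE on `D₀`, has type I error
at most `α`. -/
theorem powered_likelihood_split_LRT
    {𝒴 Θ : Type*} [MeasurableSpace 𝒴] [MeasurableSpace Θ]
    (μ : Measure 𝒴) [SigmaFinite μ] (n : ℕ)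
    (p : Θ → 𝒴 → ℝ≥0∞) (hp_meas : Measurable (Function.uncurry p))
    (hp1 : ∀ θ, ∫⁻ y, p θ y ∂μ = 1)
    [∀ θ, IsProbabilityMeasure (μ.withDensity (p θ))]
    (Θ₀ : Set Θ) (θstar : Θ)
    (hat1 : (Fin n → 𝒴) → Θ) (hhat1 : Measurable hat1)
    (mle0 : (Fin n → 𝒴) → Θ) (hmle0_meas : Measurable mle0)
    (hmle0_mem : ∀ d : Fin n → 𝒴, mle0 d ∈ Θ₀)
    (hmle0_max : ∀ d : Fin n → 𝒴, ∀ θ ∈ Θ₀, (∏ i, p θ (d i)) ≤ ∏ i, p (mle0 d) (d i))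
    (η : ℝ) (hη : η ∈ Set.Ioo (0 : ℝ) 1)
    (α : ℝ) (hα : α ∈ Set.Ioo (0 : ℝ) 1) :
    (∀ d₁ : Fin n → 𝒴,
      (∫⁻ d₀ : Fin n → 𝒴,
          ((∏ i, p (hat1 d₁) (d₀ i)) / (∏ i, p θstar (d₀ i))) ^ η
          ∂(Measure.pi fun _ : Fin n => μ.withDensity (p θstar)))
        = ∏ _i : Fin n, ∫⁻ y, p (hat1 d₁) y ^ η * p θstar y ^ (1 - η) ∂μ ∧
      (∫⁻ d₀ : Fin n → 𝒴,
          ((∏ i, p (hat1 d₁) (d₀ i)) / (∏ i, p θstar (d₀ i))) ^ η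
          ∂(Measure.pi fun _ : Fin n => μ.withDensity (p θstar))) ≤ 1) ∧
    (θstar ∈ Θ₀ →
      ((Measure.pi fun _ : Fin n => μ.withDensity (p θstar)).prod
          (Measure.pi fun _ : Fin n => μ.withDensity (p θstar)))
          {ω : (Fin n → 𝒴) × (Fin n → 𝒴) |
            ENNReal.ofReal (1 / α) <
              ((∏ i, p (hat1 ω.2) (ω.1 i)) / (∏ i, p (mle0 ω.1) (ω.1 i))) ^ η}
        ≤ ENNReal.ofReal α) := by
  obtain ⟨hη0, hη1⟩ := hη
  have hp (θ : Θ) : Measurable (p θ) := hp_meas.of_uncurry_left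
  have h_eq (d₁ : Fin n → 𝒴) := lintegral_pi_likelihood_ratio_rpow (ι := Fin n) μ (hp θstar)
    (hp (hat1 d₁)) (by simp [hp1]) hη0.le hη1
  have h_le (d₁ : Fin n → 𝒴) :
      ∏ _i : Fin n, ∫⁻ y, p (hat1 d₁) y ^ η * p θstar y ^ (1 - η) ∂μ ≤ 1 := by
    refine Finset.prod_le_one' fun i _ => ?_
    simpa [hp1] using ENNReal.lintegral_mul_norm_pow_le (μ := μ) (hp (hat1 d₁)).aemeasurable
      (hp θstar).aemeasurable hη0.le (sub_nonneg.2 hη1.le) (add_sub_cancel η 1)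
  refine ⟨fun d₁ => ⟨h_eq d₁, (h_eq d₁).trans_le (h_le d₁)⟩, fun hθ => ?_⟩
  set P := Measure.pi fun _ : Fin n => μ.withDensity (p θstar)
  let R : (Fin n → 𝒴) × (Fin n → 𝒴) → ℝ≥0∞ := fun ω =>
    ((∏ i, p (hat1 ω.2) (ω.1 i)) / ∏ i, p θstar (ω.1 i)) ^ η
  have hR : Measurable R := by
    refine Measurable.pow_const (Measurable.div ?_ ?_) η
    · exact Finset.measurable_fun_prod _ fun i _ => hp_meas.comp
        ((hhat1.comp measurable_snd).prodMk ((measurable_pi_apply i).comp measurable_fst))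
    · exact Finset.measurable_fun_prod _ fun i _ =>
        (hp θstar).comp ((measurable_pi_apply i).comp measurable_fst)
  have hR_int : ∫⁻ ω, R ω ∂(P.prod P) ≤ 1 := by
    rw [lintegral_prod_symm' R hR]
    calc ∫⁻ d₁, ∫⁻ d₀, R (d₀, d₁) ∂P ∂P ≤ ∫⁻ _, 1 ∂P :=
          lintegral_mono fun d₁ => (h_eq d₁).trans_le (h_le d₁)
      _ = 1 := by simp
  have hα_inv : ENNReal.ofReal (1 / α) = (ENNReal.ofReal α)⁻¹ := by
    rw [one_div, ENNReal.ofReal_inv_of_pos hα.1]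
  calc (P.prod P) {ω | ENNReal.ofReal (1 / α) <
          ((∏ i, p (hat1 ω.2) (ω.1 i)) / ∏ i, p (mle0 ω.1) (ω.1 i)) ^ η}
      ≤ (P.prod P) {ω | ENNReal.ofReal (1 / α) ≤ R ω} :=
        measure_mono fun ω hω => hω.le.trans <| ENNReal.rpow_le_rpow
          (ENNReal.div_le_div_left (hmle0_max ω.1 θstar hθ) _) hη0.le
    _ ≤ (∫⁻ ω, R ω ∂(P.prod P)) / ENNReal.ofReal (1 / α) :=
        meas_ge_le_lintegral_div hR.aemeasurable
          (ENNReal.ofReal_pos.2 (one_div_pos.2 hα.1)).ne' ENNReal.ofReal_ne_top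
    _ ≤ 1 / ENNReal.ofReal (1 / α) := ENNReal.div_le_div_right hR_int _
    _ = ENNReal.ofReal α := by rw [hα_inv, one_div, inv_inv]
end

section
/- (Reversed information projection inequality for convex families) Let 𝒫 be a convex collection of probability densities with respect to μ, let q be a probability density with inf_{p∈𝒫} K(q,p) < ∞, and suppose there exists p* ∈ 𝒫 attaining this infimum: K(q,p*) = inf_{p∈𝒫} K(q,p). Then for every p ∈ 𝒫, ∫ (p(y)/p*(y)) q(y) dμ(y) ≤ 1, i.e., E_{Y∼q}[p(Y)/p*(Y)] ≤ 1. -/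
open MeasureTheory
open scoped ENNReal Classical

/-- The Kullback–Leibler divergence `K(q,p) = ∫ q log(q/p) dμ` of the density `q` from the
density `p`, valued in `EReal`: it is `⊤` unless `q ≪ p` (i.e. `q` vanishes a.e. where `p`
does) and `q log(q/p)` is integrable, in which case it is the corresponding integral.
(For densities with `∫ q dμ = 1`, the negative part of `q log(q/p)` is always integrable,
so non-integrability corresponds exactly to `K(q,p) = +∞`.) -/
noncomputable def klDivFn {𝒴 : Type*} [MeasurableSpace 𝒴] (μ : Measure 𝒴)
    (q p : 𝒴 → ℝ≥0∞) : EReal :=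
  if μ {y | p y = 0 ∧ q y ≠ 0} = 0 ∧
      Integrable (fun y => (q y).toReal * Real.log ((q y).toReal / (p y).toReal)) μ
  then ((∫ y, (q y).toReal * Real.log ((q y).toReal / (p y).toReal) ∂μ : ℝ) : EReal)
  else ⊤

/-- The pointwise lower bound `q - m ≤ q log (q / m)`. -/
lemma sub_le_mul_log_div {Q M : ℝ} (hQ : 0 ≤ Q) (hM : 0 ≤ M) (h : M = 0 → Q = 0) :
    Q - M ≤ Q * Real.log (Q / M) := by
  rcases hQ.eq_or_lt with rfl | hQ
  · simpa using hM
  have hM : 0 < M := hM.lt_of_ne fun h0 => hQ.ne' (h h0.symm)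
  have h1 := mul_le_mul_of_nonneg_left (Real.one_sub_inv_le_log_of_pos (div_pos hQ hM)) hQ.le
  have h2 : Q * (1 - (Q / M)⁻¹) = Q - M := by field_simp
  linarith

lemma mul_log_div_mixture_le {Q P S t : ℝ} (hQ : 0 ≤ Q) (hP : 0 ≤ P) (hS : 0 ≤ S)
    (h : S = 0 → Q = 0) (ht0 : 0 < t) (ht1 : t < 1) :
    Q * Real.log (Q / (t * P + (1 - t) * S)) ≤
      Q * Real.log (Q / S) - Q * Real.log (1 - t) := by
  rcases hQ.eq_or_lt with rfl | hQ
  · simp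
  have hS : 0 < S := hS.lt_of_ne fun h0 => hQ.ne' (h h0.symm)
  have ht : 0 < 1 - t := sub_pos.2 ht1
  have hle : (1 - t) * S ≤ t * P + (1 - t) * S := le_add_of_nonneg_left (by positivity)
  have hlog := Real.log_le_log (by positivity) hle
  rw [Real.log_mul ht.ne' hS.ne'] at hlog
  rw [Real.log_div hQ.ne' (by positivity), Real.log_div hQ.ne' hS.ne', ← mul_sub]
  exact mul_le_mul_of_nonneg_left (by linarith) hQ.le

lemma mul_div_mixture_sub_le {Q P S t : ℝ} (hQ : 0 ≤ Q) (hP : 0 ≤ P) (hS : 0 ≤ S)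
    (h : S = 0 → Q = 0) (ht0 : 0 < t) (ht1 : t < 1) :
    t / (1 - t) * (Q * (P / (t * P + (1 - t) * S)) - Q) ≤
      Q * Real.log (Q / S) - Q * Real.log (Q / (t * P + (1 - t) * S)) := by
  rcases hQ.eq_or_lt with rfl | hQ
  · simp
  have hS : 0 < S := hS.lt_of_ne fun h0 => hQ.ne' (h h0.symm)
  have ht : 0 < 1 - t := sub_pos.2 ht1
  have hM : 0 < t * P + (1 - t) * S := by positivity
  have hlog := mul_le_mul_of_nonneg_left
    (Real.one_sub_inv_le_log_of_pos (div_pos hM hS)) hQ.le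
  rw [Real.log_div hM.ne' hS.ne'] at hlog
  rw [Real.log_div hQ.ne' hM.ne', Real.log_div hQ.ne' hS.ne']
  have heq : t / (1 - t) * (Q * (P / (t * P + (1 - t) * S)) - Q) =
      Q * (1 - ((t * P + (1 - t) * S) / S)⁻¹) := by
    field_simp
    ring
  rw [heq]
  linarith

lemma div_mixture_le_inv {P S t : ℝ} (hP : 0 ≤ P) (hS : 0 ≤ S) (ht0 : 0 < t) (ht1 : t < 1) :
    P / (t * P + (1 - t) * S) ≤ t⁻¹ := by
  have ht : 0 < 1 - t := sub_pos.2 ht1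
  refine div_le_of_le_mul₀ (by positivity) (by positivity) ?_
  have h0 : 0 ≤ t⁻¹ * ((1 - t) * S) := by positivity
  have h1 : t⁻¹ * (t * P) = P := by field_simp
  linarith [mul_add t⁻¹ (t * P) ((1 - t) * S)]

lemma toReal_mixture {a b : ℝ≥0∞} (ha : a ≠ ⊤) (hb : b ≠ ⊤) {t : ℝ} (ht0 : 0 ≤ t)
    (ht1 : t ≤ 1) :
    (ENNReal.ofReal t * a + ENNReal.ofReal (1 - t) * b).toReal =
      t * a.toReal + (1 - t) * b.toReal := by
  rw [ENNReal.toReal_add (ENNReal.mul_ne_top ENNReal.ofReal_ne_top ha)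
    (ENNReal.mul_ne_top ENNReal.ofReal_ne_top hb), ENNReal.toReal_mul, ENNReal.toReal_mul,
    ENNReal.toReal_ofReal ht0, ENNReal.toReal_ofReal (sub_nonneg.2 ht1)]

lemma klDivFn_ne_top_iff {𝒴 : Type*} [MeasurableSpace 𝒴] {μ : Measure 𝒴} {q p : 𝒴 → ℝ≥0∞} :
    klDivFn μ q p ≠ ⊤ ↔ μ {y | p y = 0 ∧ q y ≠ 0} = 0 ∧
      Integrable (fun y => (q y).toReal * Real.log ((q y).toReal / (p y).toReal)) μ := by
  unfold klDivFn
  split_ifs with h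
  · exact iff_of_true (EReal.coe_ne_top _) h
  · exact iff_of_false (not_not.2 rfl) h

lemma klDivFn_of_ne_top {𝒴 : Type*} [MeasurableSpace 𝒴] {μ : Measure 𝒴} {q p : 𝒴 → ℝ≥0∞}
    (h : klDivFn μ q p ≠ ⊤) :
    klDivFn μ q p =
      ((∫ y, (q y).toReal * Real.log ((q y).toReal / (p y).toReal) ∂μ : ℝ) : EReal) :=
  if_pos (klDivFn_ne_top_iff.1 h)

/-- If `K(q,s)` is finite and does not exceed `K(q, t p + (1 - t) s)` for some `0 < t < 1`, then
`∫ q p / (t p + (1 - t) s) dμ ≤ 1`. -/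
lemma lintegral_mul_div_mixture_le_one {𝒴 : Type*} [MeasurableSpace 𝒴] {μ : Measure 𝒴}
    {p q s : 𝒴 → ℝ≥0∞} (hp : Measurable p) (hp1 : ∫⁻ y, p y ∂μ ≠ ⊤)
    (hs : Measurable s) (hs1 : ∫⁻ y, s y ∂μ ≠ ⊤)
    (hq : Measurable q) (hq1 : ∫⁻ y, q y ∂μ = 1) (hfin : klDivFn μ q s ≠ ⊤)
    {t : ℝ} (ht0 : 0 < t) (ht1 : t < 1)
    (hle : klDivFn μ q s ≤
      klDivFn μ q (fun y => ENNReal.ofReal t * p y + ENNReal.ofReal (1 - t) * s y)) :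
    ∫⁻ y, ENNReal.ofReal ((q y).toReal *
      ((p y).toReal / (t * (p y).toReal + (1 - t) * (s y).toReal))) ∂μ ≤ 1 := by
  have hq1' : ∫⁻ y, q y ∂μ ≠ ⊤ := by simp [hq1]
  have ht : 0 < 1 - t := sub_pos.2 ht1
  have hpI := integrable_toReal_of_lintegral_ne_top hp.aemeasurable hp1
  have hsI := integrable_toReal_of_lintegral_ne_top hs.aemeasurable hs1
  have hqI := integrable_toReal_of_lintegral_ne_top hq.aemeasurable hq1'
  obtain ⟨hnull, hfI⟩ := klDivFn_ne_top_iff.1 hfin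
  have hac : ∀ᵐ y ∂μ, (s y).toReal = 0 → (q y).toReal = 0 := by
    filter_upwards [measure_eq_zero_iff_ae_notMem.1 hnull, ae_lt_top hs hs1] with y hy hsy h0
    have : q y = 0 := by
      by_contra hqy
      exact hy ⟨((ENNReal.toReal_eq_zero_iff _).1 h0).resolve_right hsy.ne, hqy⟩
    simp [this]
  have hmix : ∀ᵐ y ∂μ, (ENNReal.ofReal t * p y + ENNReal.ofReal (1 - t) * s y).toReal =
      t * (p y).toReal + (1 - t) * (s y).toReal := by
    filter_upwards [ae_lt_top hp hp1, ae_lt_top hs hs1] with y h1 h2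
    exact toReal_mixture h1.ne h2.ne ht0.le ht1.le
  have hgI : Integrable (fun y => (q y).toReal * Real.log ((q y).toReal /
      (ENNReal.ofReal t * p y + ENNReal.ofReal (1 - t) * s y).toReal)) μ := by
    refine integrable_of_le_of_le (Measurable.aestronglyMeasurable (by fun_prop)) ?_ ?_
      (hqI.sub ((hpI.const_mul t).add (hsI.const_mul (1 - t))))
      (hfI.sub (hqI.mul_const (Real.log (1 - t))))
    · filter_upwards [hac, hmix] with y hy hm
      simp only [hm, Pi.sub_apply, Pi.add_apply]
      refine sub_le_mul_log_div ENNReal.toReal_nonneg (by positivity) fun h0 => hy ?_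
      have h1 : 0 ≤ t * (p y).toReal := by positivity
      have h2 : 0 ≤ (1 - t) * (s y).toReal := by positivity
      exact (mul_eq_zero.1 (by linarith)).resolve_left ht.ne'
    · filter_upwards [hac, hmix] with y hy hm
      simp only [hm, Pi.sub_apply]
      exact mul_log_div_mixture_le ENNReal.toReal_nonneg ENNReal.toReal_nonneg
        ENNReal.toReal_nonneg hy ht0 ht1
  have hmix_fin : klDivFn μ q
      (fun y => ENNReal.ofReal t * p y + ENNReal.ofReal (1 - t) * s y) ≠ ⊤ := by
    refine klDivFn_ne_top_iff.2 ⟨measure_mono_null ?_ hnull, hgI⟩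
    rintro y ⟨h0, hqy⟩
    simp only [add_eq_zero, mul_eq_zero, ENNReal.ofReal_eq_zero, ht.not_ge, false_or] at h0
    exact ⟨h0.2, hqy⟩
  rw [klDivFn_of_ne_top hfin, klDivFn_of_ne_top hmix_fin, EReal.coe_le_coe_iff] at hle
  have hrI : Integrable (fun y => (q y).toReal *
      ((p y).toReal / (t * (p y).toReal + (1 - t) * (s y).toReal))) μ := by
    refine (hqI.mul_const t⁻¹).mono' (Measurable.aestronglyMeasurable (by fun_prop))
      (ae_of_all _ fun y => ?_)
    rw [Real.norm_of_nonneg (by positivity)]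
    exact mul_le_mul_of_nonneg_left (div_mixture_le_inv ENNReal.toReal_nonneg
      ENNReal.toReal_nonneg ht0 ht1) ENNReal.toReal_nonneg
  have hint : ∫ y, t / (1 - t) * ((q y).toReal *
      ((p y).toReal / (t * (p y).toReal + (1 - t) * (s y).toReal)) - (q y).toReal) ∂μ ≤
      ∫ y, ((q y).toReal * Real.log ((q y).toReal / (s y).toReal) -
        (q y).toReal * Real.log ((q y).toReal /
          (ENNReal.ofReal t * p y + ENNReal.ofReal (1 - t) * s y).toReal)) ∂μ := by
    refine integral_mono_ae ((hrI.sub hqI).const_mul _) (hfI.sub hgI) ?_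
    filter_upwards [hac, hmix] with y hy hm
    simp only [hm]
    exact mul_div_mixture_sub_le ENNReal.toReal_nonneg ENNReal.toReal_nonneg
      ENNReal.toReal_nonneg hy ht0 ht1
  have hqint : ∫ y, (q y).toReal ∂μ = 1 := by
    rw [integral_toReal hq.aemeasurable (ae_lt_top hq hq1'), hq1, ENNReal.toReal_one]
  rw [integral_const_mul, integral_sub hrI hqI, integral_sub hfI hgI, hqint] at hint
  have hle1 := nonpos_of_mul_nonpos_right (hint.trans (sub_nonpos.2 hle)) (div_pos ht0 ht)
  rw [← ofReal_integral_eq_lintegral_ofReal hrI (ae_of_all _ fun y => by positivity)]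
  exact ENNReal.ofReal_le_one.2 (sub_nonpos.1 hle1)

/-- **Reversed information projection inequality for convex families.**
Let `Pcal` be a convex collection of probability densities with respect to `μ`, let `q` be
a probability density whose Kullback–Leibler divergence from `Pcal` is finite, and suppose
`p* ∈ Pcal` attains `inf_{p ∈ Pcal} K(q,p)`.  Then for every `p ∈ Pcal`,
`E_{Y∼q}[p(Y)/p*(Y)] = ∫ (p/p*) q dμ ≤ 1`. -/
theorem reversed_information_projection_inequality
    {𝒴 : Type*} [MeasurableSpace 𝒴] (μ : Measure 𝒴) [SigmaFinite μ]
    (Pcal : Set (𝒴 → ℝ≥0∞))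
    (hdens : ∀ p ∈ Pcal, Measurable p ∧ ∫⁻ y, p y ∂μ = 1)
    (hconv : ∀ p₁ ∈ Pcal, ∀ p₂ ∈ Pcal, ∀ t : ℝ, 0 ≤ t → t ≤ 1 →
      (fun y => ENNReal.ofReal t * p₁ y + ENNReal.ofReal (1 - t) * p₂ y) ∈ Pcal)
    (q : 𝒴 → ℝ≥0∞) (hq_meas : Measurable q) (hq1 : ∫⁻ y, q y ∂μ = 1)
    (pstar : 𝒴 → ℝ≥0∞) (hpstar : pstar ∈ Pcal)
    (hfin : klDivFn μ q pstar ≠ ⊤)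
    (hmin : ∀ p ∈ Pcal, klDivFn μ q pstar ≤ klDivFn μ q p) :
    ∀ p ∈ Pcal, ∫⁻ y, (p y / pstar y) * q y ∂μ ≤ 1 := by
  intro p hpP
  obtain ⟨hp, hp1⟩ := hdens p hpP
  obtain ⟨hs, hs1⟩ := hdens pstar hpstar
  have hp1' : ∫⁻ y, p y ∂μ ≠ ⊤ := by simp [hp1]
  have hs1' : ∫⁻ y, pstar y ∂μ ≠ ⊤ := by simp [hs1]
  have hq1' : ∫⁻ y, q y ∂μ ≠ ⊤ := by simp [hq1]
  obtain ⟨t, -, ht, hlim⟩ := exists_seq_strictAnti_tendsto' (zero_lt_one' ℝ)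
  let F : ℕ → 𝒴 → ℝ≥0∞ := fun n y => ENNReal.ofReal ((q y).toReal *
    ((p y).toReal / (t n * (p y).toReal + (1 - t n) * (pstar y).toReal)))
  have hF1 : ∀ n, ∫⁻ y, F n y ∂μ ≤ 1 := fun n =>
    lintegral_mul_div_mixture_le_one hp hp1' hs hs1' hq_meas hq1 hfin (ht n).1 (ht n).2
      (hmin _ (hconv p hpP pstar hpstar (t n) (ht n).1.le (ht n).2.le))
  have hFlim : ∀ᵐ y ∂μ,
      Filter.Tendsto (fun n => F n y) Filter.atTop (nhds (p y / pstar y * q y)) := by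
    filter_upwards [measure_eq_zero_iff_ae_notMem.1 (klDivFn_ne_top_iff.1 hfin).1,
      ae_lt_top hp hp1', ae_lt_top hs hs1', ae_lt_top hq_meas hq1'] with y hy hpy hsy hqy
    by_cases hq0 : q y = 0
    · simp [F, hq0]
    have hs0 : pstar y ≠ 0 := fun h0 => hy ⟨h0, hq0⟩
    have hs0' : (pstar y).toReal ≠ 0 := (ENNReal.toReal_pos hs0 hsy.ne).ne'
    have hval : p y / pstar y * q y =
        ENNReal.ofReal ((q y).toReal * ((p y).toReal / (pstar y).toReal)) := by
      rw [← ENNReal.toReal_div, ← ENNReal.toReal_mul, ENNReal.ofReal_toReal, mul_comm]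
      exact ENNReal.mul_ne_top hqy.ne (ENNReal.div_ne_top hpy.ne hs0)
    rw [hval]
    have hden : Filter.Tendsto
        (fun n => t n * (p y).toReal + (1 - t n) * (pstar y).toReal) Filter.atTop
        (nhds (pstar y).toReal) := by
      simpa using (hlim.mul_const (p y).toReal).add
        ((hlim.const_sub 1).mul_const (pstar y).toReal)
    exact ENNReal.tendsto_ofReal ((tendsto_const_nhds.div hden hs0').const_mul _)
  calc ∫⁻ y, p y / pstar y * q y ∂μ
      = ∫⁻ y, Filter.liminf (fun n => F n y) Filter.atTop ∂μ :=
        lintegral_congr_ae (hFlim.mono fun y hy => hy.liminf_eq.symm)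
    _ ≤ Filter.liminf (fun n => ∫⁻ y, F n y ∂μ) Filter.atTop :=
        lintegral_liminf_le fun n => by fun_prop
    _ ≤ Filter.liminf (fun _ : ℕ => (1 : ℝ≥0∞)) Filter.atTop :=
        Filter.liminf_le_liminf (Filter.Eventually.of_forall hF1)
    _ = 1 := Filter.liminf_const 1
end
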